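/- arXiv:math/9406207 — 2 statements merged into one kernel-verified Lean document; each statement's English description precedes it below -/
import Mathlib

section
/- Let H̄ be the group with presentation ⟨x, y | x^{31} = 1, y^{31} = 1, (x^2y)^2 = 1, (xy^2)^2 = 1, (x^3y^{-11})^2 = 1, (x^4y^{13})^2 = 1⟩. Then H̄ is finite of order 32736. -/
/-- The relators of ⟨x, y | x³¹ = y³¹ = (x²y)² = (xy²)² = (x³y⁻¹¹)² = (x⁴y¹³)² = 1⟩. -/
def Hrels : Set (FreeGroup (Fin 2)) :=
  {(FreeGroup.of 0) ^ 31, (FreeGroup.of 1) ^ 31,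
   ((FreeGroup.of 0) ^ 2 * FreeGroup.of 1) ^ 2,
   (FreeGroup.of 0 * (FreeGroup.of 1) ^ 2) ^ 2,
   ((FreeGroup.of 0) ^ 3 * (FreeGroup.of 1) ^ (-11 : ℤ)) ^ 2,
   ((FreeGroup.of 0) ^ 4 * (FreeGroup.of 1) ^ 13) ^ 2}

/-- The group H̄ = ⟨x, y | x³¹ = y³¹ = (x²y)² = (xy²)² = (x³y⁻¹¹)² = (x⁴y¹³)² = 1⟩. -/
abbrev Hbar : Type := PresentedGroup Hrels

section AlternatingWords

variable {G : Type*} [Group G]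

/-- `altProd x y [a, b, c, …] = x ^ a * y ^ b * x ^ c * ⋯`. -/
def altProd : G → G → List ℤ → G
  | _, _, [] => 1
  | x, y, a :: l => x ^ a * altProd y x l

/-- For every pair `(i, j)` of the list, `x ^ i * y ^ j` squares to the identity. -/
def SquaresToOne (x y : G) (P : List (ℤ × ℤ)) : Prop :=
  ∀ p ∈ P, (x ^ p.1 * y ^ p.2) ^ 2 = 1

/-- An exponent `i` such that `P` provides the relation `(x ^ i * y ^ j) ^ 2 = 1`, where the
exponents are read modulo `31`. -/
def partner (P : List (ℤ × ℤ)) (j : ℤ) : Option ℤ :=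
  P.findSome? fun p =>
    if (j - p.2) % 31 = 0 then some p.1 else if (j + p.2) % 31 = 0 then some (-p.1) else none

/-- Replays a sequence of moves on a cyclic alternating word, given the pairs `P` of exponents for
which `x ^ i * y ^ j` is an involution, and checks that the resulting word is trivial. The move
`(n, k)` rotates the word by `n` letters, and then rewrites its second letter: if that letter is
trivial, the amount `k` is moved from the third exponent to the first one; otherwise
`x ^ a * y ^ j * x ^ b` is replaced by `x ^ (a - i) * y ^ (-j) * x ^ (b - i)`. -/
def reduces : List (ℤ × ℤ) → List ℤ → List (ℕ × ℤ) → Bool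
  | _, w, [] => w.all fun a => a % 31 = 0
  | P, w, (n, k) :: ms =>
    let Q := if n % 2 = 0 then P else P.map Prod.swap
    match w.rotate n with
    | a :: j :: b :: l =>
      if j % 31 = 0 then reduces Q ((a + k) :: 0 :: (b - k) :: l) ms
      else match partner Q j with
        | some i => reduces Q ((a - i) :: (-j) :: (b - i) :: l) ms
        | none => false
    | _ => false

variable {x y : G}

theorem zpow_eq_one_of_emod (hx : x ^ 31 = 1) {a : ℤ} (ha : a % 31 = 0) : x ^ a = 1 := by
  obtain ⟨b, rfl⟩ := Int.dvd_of_emod_eq_zero ha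
  rw [zpow_mul, show x ^ (31 : ℤ) = 1 from mod_cast hx, one_zpow]

theorem zpow_eq_zpow_of_emod (hx : x ^ 31 = 1) {a b : ℤ} (h : (a - b) % 31 = 0) :
    x ^ a = x ^ b := by
  rw [← sub_add_cancel a b, zpow_add, zpow_eq_one_of_emod hx h, one_mul]

theorem SquaresToOne.cons {P : List (ℤ × ℤ)} {p : ℤ × ℤ} (h : SquaresToOne x y P)
    (hp : (x ^ p.1 * y ^ p.2) ^ 2 = 1) : SquaresToOne x y (p :: P) :=
  List.forall_mem_cons.2 ⟨hp, h⟩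

theorem SquaresToOne.swap {P : List (ℤ × ℤ)} (h : SquaresToOne x y P) :
    SquaresToOne y x (P.map Prod.swap) := by
  intro p hp
  obtain ⟨⟨i, j⟩, hij, rfl⟩ := List.mem_map.1 hp
  calc (y ^ j * x ^ i) ^ 2 = y ^ j * (x ^ i * y ^ j) ^ 2 * (y ^ j)⁻¹ := by
        simp only [pow_two, mul_assoc, mul_inv_cancel, mul_one]
    _ = 1 := by rw [h _ hij, mul_one, mul_inv_cancel]

theorem SquaresToOne.flip {P : List (ℤ × ℤ)} {i j : ℤ} (h : SquaresToOne x y P)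
    (hy : y ^ 31 = 1) (hij : partner P j = some i) :
    y ^ j = x ^ (-i) * y ^ (-j) * x ^ (-i) := by
  have eq_conj {a b : G} (hab : (a * b) ^ 2 = 1) : b = a⁻¹ * b⁻¹ * a⁻¹ :=
    calc b = a⁻¹ * (a * b) ^ 2 * b⁻¹ * a⁻¹ := by simp [pow_two, mul_assoc]
      _ = a⁻¹ * b⁻¹ * a⁻¹ := by rw [hab, mul_one]
  obtain ⟨p, hp, hpi⟩ := List.exists_of_findSome?_eq_some hij
  have hsq := eq_conj (h p hp)
  split_ifs at hpi with h₁ h₂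
  · obtain rfl : p.1 = i := by simpa using hpi
    rwa [zpow_neg y, zpow_neg x, zpow_eq_zpow_of_emod hy h₁]
  · obtain rfl : -p.1 = i := by simpa using hpi
    have hj : y ^ j = (y ^ p.2)⁻¹ := by
      rw [← zpow_neg]
      exact zpow_eq_zpow_of_emod hy (by simpa using h₂)
    rw [zpow_neg y, hj, neg_neg, inv_inv]
    nth_rw 1 [hsq]
    group

theorem altProd_append_singleton (l : List ℤ) (a : ℤ) (x y : G) :
    altProd x y (l ++ [a]) = altProd x y l * (if l.length % 2 = 0 then x else y) ^ a := by
  induction l generalizing x y with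
  | nil => simp [altProd]
  | cons b l ih =>
    simp only [List.cons_append, altProd, ih, List.length_cons, mul_assoc]
    congr 3
    split_ifs <;> first | rfl | omega

theorem altProd_eq_one_of_rotate (n : ℕ) {w : List ℤ} (hw : w.length % 2 = 0)
    (h : altProd (if n % 2 = 0 then x else y) (if n % 2 = 0 then y else x) (w.rotate n) = 1) :
    altProd x y w = 1 := by
  induction n generalizing x y w with
  | zero => simpa using h
  | succ n ih =>
    cases w with
    | nil => rfl
    | cons a l =>
      rw [List.rotate_cons_succ] at h
      rw [List.length_cons] at hw
      have key : altProd y x (l ++ [a]) = 1 := by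
        refine ih (by simpa using hw) ?_
        convert h using 2 <;> split_ifs <;> first | rfl | omega
      rw [altProd_append_singleton, if_neg (by omega)] at key
      rw [altProd]
      exact mul_eq_one_iff_eq_inv.2 (mul_eq_one_iff_eq_inv'.1 key)

theorem altProd_eq_one_of_all {w : List ℤ} (hx : x ^ 31 = 1) (hy : y ^ 31 = 1)
    (hw : ∀ a ∈ w, a % 31 = 0) : altProd x y w = 1 := by
  induction w generalizing x y with
  | nil => rfl
  | cons a l ih =>
    rw [altProd, zpow_eq_one_of_emod hx (hw a (by simp)), one_mul]
    exact ih hy hx fun b hb => hw b (by simp [hb])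

theorem altProd_eq_one_of_reduces {P : List (ℤ × ℤ)} {w : List ℤ} {ms : List (ℕ × ℤ)}
    (hP : SquaresToOne x y P) (hx : x ^ 31 = 1) (hy : y ^ 31 = 1) (hw : w.length % 2 = 0)
    (h : reduces P w ms = true) : altProd x y w = 1 := by
  induction ms generalizing P w x y with
  | nil => exact altProd_eq_one_of_all hx hy (by simpa [reduces] using h)
  | cons m ms ih =>
    obtain ⟨n, k⟩ := m
    refine altProd_eq_one_of_rotate n hw ?_
    have hQ : SquaresToOne (if n % 2 = 0 then x else y) (if n % 2 = 0 then y else x)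
        (if n % 2 = 0 then P else P.map Prod.swap) := by
      split_ifs
      exacts [hP, hP.swap]
    have hx' : (if n % 2 = 0 then x else y) ^ 31 = 1 := by split_ifs <;> assumption
    have hy' : (if n % 2 = 0 then y else x) ^ 31 = 1 := by split_ifs <;> assumption
    generalize (if n % 2 = 0 then x else y) = x' at *
    generalize (if n % 2 = 0 then y else x) = y' at *
    rw [← List.length_rotate w n] at hw
    simp only [reduces] at h
    generalize (if n % 2 = 0 then P else P.map Prod.swap) = Q at *
    split at h
    · next a j b l hl =>
      rw [hl] at hw ⊢
      split_ifs at h with hj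
      · have := ih hQ hx' hy' (by simpa using hw) h
        simp only [altProd, zpow_eq_one_of_emod hy' hj] at this ⊢
        simp only [zpow_zero, one_mul, ← mul_assoc, ← zpow_add] at this ⊢
        rwa [add_add_sub_cancel] at this
      · split at h
        · next i hi =>
          have := ih hQ hx' hy' (by simpa using hw) h
          simp only [altProd] at this ⊢
          rw [← this, hQ.flip hy' hi, sub_eq_add_neg a, sub_eq_neg_add b, zpow_add, zpow_add]
          simp only [mul_assoc]
        · simp at h
    · simp at h

theorem sq_eq_one_of_reduces {P : List (ℤ × ℤ)} {i j : ℤ} {ms : List (ℕ × ℤ)}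
    (hP : SquaresToOne x y P) (hx : x ^ 31 = 1) (hy : y ^ 31 = 1)
    (h : reduces P [i, j, i, j, 0, 0, 0, 0] ms = true) : (x ^ i * y ^ j) ^ 2 = 1 := by
  have := altProd_eq_one_of_reduces hP hx hy (by simp) h
  simpa [altProd, pow_two, mul_assoc] using this

/-- The relations `(x ^ i * y ^ j) ^ 2 = 1` that follow from the defining relations of `Hbar`. -/
def involutionExponents : List (ℤ × ℤ) :=
  [(5, -14), (8, -12), (14, -5), (7, -6), (12, -8), (15, 9), (9, 15), (6, -7), (13,
   4), (11, -3), (1, 2), (2, 1), (3, -11), (4, 13)]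

theorem squaresToOne_involutionExponents (hx : x ^ 31 = 1) (hy : y ^ 31 = 1)
    (h : SquaresToOne x y [(1, 2), (2, 1), (3, -11), (4, 13)]) :
    SquaresToOne x y involutionExponents := by
  replace h := h.cons (p := (11, -3)) (sq_eq_one_of_reduces h hx hy
    (ms := [(3, 1), (7, 0), (4, 2), (7, 0), (7, 0), (1, 0), (1, 0), (7, 0), (1,
      0), (7, 0), (1, 0), (7, 0), (1, 0), (7, 0), (1, 0), (1, 0), (7, 0), (1, 0),
      (1, 0), (7, 0), (1, 0), (7, 0), (1, 0), (7, 0), (1, 0), (7, 0), (1, 0), (1,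
      0), (6, 0), (1, -2), (5, 0), (1, -1), (6, 0), (7, -1)]) rfl)
  replace h := h.cons (p := (13, 4)) (sq_eq_one_of_reduces h hx hy
    (ms := [(4, 10), (2, 12), (1, 0), (1, 0), (7, 0), (6, 0), (1, 0), (7, 0), (7,
      0), (1, 0), (7, 0), (1, 0), (7, 0), (1, 0), (7, 0), (7, 0), (2, 0), (7, 3),
      (1, 0), (1, 0), (7, 0), (7, 0), (7, -3), (4, 0), (1, 0), (7, 0), (1, 0), (7,
      0), (1, 0), (7, 0), (1, 0), (7, 0), (7, 0), (1, 0), (1, 4), (6, 0), (7, -1)]) rfl)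
  replace h := h.cons (p := (6, -7)) (sq_eq_one_of_reduces h hx hy
    (ms := [(6, 2), (6, -13), (7, 0), (7, 0), (1, 0), (7, 0), (5, 0), (1, 0), (1,
      0), (1, 0), (1, 0), (1, 0), (1, 0), (2, 0), (1, 0), (7, 0), (7, 0), (4, 0),
      (1, -5), (1, -2), (5, 0), (1, 0), (6, 0), (1, 0), (6, 0), (1, 0), (1, 0), (7,
      0), (1, 0), (7, 0), (1, 0), (7, 0), (1, 0), (7, 0), (1, 0), (7, 0), (1, 0),
      (7, 0), (1, 0), (7, 0), (1, 0), (1, 0), (6, 0), (1, -2), (6, -1)]) rfl)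
  replace h := h.cons (p := (9, 15)) (sq_eq_one_of_reduces h hx hy
    (ms := [(3, 5), (7, 0), (7, 0), (1, 0), (1, 0), (7, 0), (7, 0), (1, 0), (7,
      0), (1, 0), (6, -9), (3, -7)]) rfl)
  replace h := h.cons (p := (15, 9)) (sq_eq_one_of_reduces h hx hy
    (ms := [(6, -3), (1, 0), (1, 0), (7, 0), (7, 0), (2, 0), (7, 0), (7, 0), (2,
      0), (7, 0), (7, 0), (2, 0), (7, 0), (7, 0), (2, 0), (1, 9), (6, -4)]) rfl)
  replace h := h.cons (p := (12, -8)) (sq_eq_one_of_reduces h hx hy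
    (ms := [(3, -5), (7, 0), (7, 0), (1, 0), (7, 0), (1, 0), (1, 0), (7, 0), (7,
      0), (7, 0), (2, 0), (7, 0), (7, 0), (2, 0), (1, -11), (6, -9)]) rfl)
  replace h := h.cons (p := (7, -6)) (sq_eq_one_of_reduces h hx hy
    (ms := [(3, 14), (7, 0), (7, 0), (1, 0), (7, 0), (2, 0), (7, 0), (7, 0), (7,
      0), (1, 0), (1, 0), (7, 0), (7, 12), (3, -3)]) rfl)
  replace h := h.cons (p := (14, -5)) (sq_eq_one_of_reduces h hx hy
    (ms := [(6, 13), (1, 0), (1, 0), (7, 0), (1, 0), (6, 0), (1, 0), (1, 0), (7,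
      0), (7, -1), (3, -5)]) rfl)
  replace h := h.cons (p := (8, -12)) (sq_eq_one_of_reduces h hx hy
    (ms := [(6, 2), (1, 0), (1, 0), (7, 0), (1, 0), (7, 0), (7, 0), (1, 0), (7,
      0), (2, 0), (1, -12), (6, -5)]) rfl)
  replace h := h.cons (p := (5, -14)) (sq_eq_one_of_reduces h hx hy
    (ms := [(3, 13), (7, 0), (7, 0), (1, 0), (7, 0), (7, 0), (1, 0), (7, 0), (2,
      0), (1, -13), (6, -1)]) rfl)
  exact h

end AlternatingWords

section BruhatDecomposition

variable {G : Type*} [Group G]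

/-- The elements `1` and `x ^ k * t * x ^ (-k)`, where `0 ≤ k < 31`. -/
def unipotent (x t : G) : Option (Fin 31) → G
  | none => 1
  | some k => x ^ k.val * t * (x ^ k.val)⁻¹

/-- The representatives `1` and `u * w`, with `u` unipotent, of the left cosets of the Borel
subgroup. -/
def bruhatCell (x t w : G) : Option (Option (Fin 31)) → G
  | none => 1
  | some u => unipotent x t u * w

/-- The Bruhat normal form `v * u * x ^ k`. -/
def bruhat (x t w : G) (p : Option (Option (Fin 31)) × Option (Fin 31) × Fin 31) : G :=
  bruhatCell x t w p.1 * (unipotent x t p.2.1 * x ^ p.2.2.val)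

/-- The relations between a generator `x` of a torus, a unipotent element `t` and a Weyl group
element `w` that bound the order of `SL(2, 32)`. -/
structure BruhatRelations (x t w : G) : Prop where
  pow_x : x ^ 31 = 1
  t_mul_t : t * t = 1
  w_mul_w : w * w = 1
  w_mul_x : w * x * w * x = 1
  braid : t * w * t * w * t * w = 1
  t_mul_conj : ∀ k : ℤ, ¬ 31 ∣ k → ∃ m : ℤ, t * (x ^ k * t * x ^ (-k)) = x ^ m * t * x ^ (-m)

namespace BruhatRelations

variable {x t w u v g : G}

theorem exists_zpow_eq (h : BruhatRelations x t w) (k : ℤ) : ∃ m : Fin 31, x ^ k = x ^ m.val := by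
  refine ⟨⟨(k % 31).toNat, by omega⟩, ?_⟩
  rw [← zpow_natCast]
  exact zpow_eq_zpow_of_emod h.pow_x (by simp; omega)

theorem w_mul_zpow (h : BruhatRelations x t w) (k : ℤ) : w * x ^ k = x ^ (-k) * w := by
  have hw : w⁻¹ = w := inv_eq_of_mul_eq_one_left h.w_mul_w
  have hwx : w * x * w⁻¹ = x⁻¹ := by rw [hw]; exact eq_inv_of_mul_eq_one_left h.w_mul_x
  rw [← mul_inv_eq_iff_eq_mul, ← conj_zpow, hwx, inv_zpow']

theorem w_mul_t_mul_w (h : BruhatRelations x t w) : w * t * w = t * w * t := by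
  have ht : t⁻¹ = t := inv_eq_of_mul_eq_one_left h.t_mul_t
  have hw : w⁻¹ = w := inv_eq_of_mul_eq_one_left h.w_mul_w
  have hb : t * w * t * (w * t * w) = 1 := by simpa only [mul_assoc] using h.braid
  rw [← inv_eq_of_mul_eq_one_right hb, mul_inv_rev, mul_inv_rev, ht, hw, mul_assoc]

theorem one_mem_unipotent : 1 ∈ Set.range (unipotent x t) := ⟨none, rfl⟩

theorem conj_mem_unipotent (h : BruhatRelations x t w) (k : ℤ) :
    x ^ k * t * x ^ (-k) ∈ Set.range (unipotent x t) := by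
  obtain ⟨m, hm⟩ := h.exists_zpow_eq k
  exact ⟨some m, by rw [zpow_neg, hm]; rfl⟩

theorem unipotent_cases (hu : u ∈ Set.range (unipotent x t)) :
    u = 1 ∨ ∃ k : ℤ, u = x ^ k * t * x ^ (-k) := by
  obtain ⟨_ | k, rfl⟩ := hu
  · exact .inl rfl
  · exact .inr ⟨k.val, by rw [zpow_neg, zpow_natCast]; rfl⟩

theorem zpow_mul_unipotent (h : BruhatRelations x t w) (k : ℤ)
    (hu : u ∈ Set.range (unipotent x t)) :
    ∃ v ∈ Set.range (unipotent x t), x ^ k * u = v * x ^ k := by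
  obtain rfl | ⟨m, rfl⟩ := unipotent_cases hu
  · exact ⟨1, hu, by simp⟩
  · exact ⟨_, h.conj_mem_unipotent (k + m), by group⟩

theorem unipotent_mul_mem (h : BruhatRelations x t w) (hu : u ∈ Set.range (unipotent x t))
    (hv : v ∈ Set.range (unipotent x t)) : u * v ∈ Set.range (unipotent x t) := by
  obtain rfl | ⟨k, rfl⟩ := unipotent_cases hu
  · rwa [one_mul]
  obtain rfl | ⟨m, rfl⟩ := unipotent_cases hv
  · rwa [mul_one]
  by_cases hkm : (31 : ℤ) ∣ m - k
  · convert one_mem_unipotent using 1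
    have hmk := zpow_eq_zpow_of_emod h.pow_x (Int.emod_eq_zero_of_dvd hkm)
    calc x ^ k * t * x ^ (-k) * (x ^ m * t * x ^ (-m))
        = x ^ k * (t * t) * x ^ (-k) := by rw [zpow_neg x m, hmk]; group
      _ = 1 := by rw [h.t_mul_t]; group
  · obtain ⟨z, hz⟩ := h.t_mul_conj _ hkm
    convert h.conj_mem_unipotent (k + z) using 1
    calc x ^ k * t * x ^ (-k) * (x ^ m * t * x ^ (-m))
        = x ^ k * (t * (x ^ (m - k) * t * x ^ (-(m - k)))) * x ^ (-k) := by group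
      _ = x ^ (k + z) * t * x ^ (-(k + z)) := by rw [hz]; group

theorem borel_mem_bruhat (h : BruhatRelations x t w) (hu : u ∈ Set.range (unipotent x t))
    (k : ℤ) : u * x ^ k ∈ Set.range (bruhat x t w) := by
  obtain ⟨m, hm⟩ := h.exists_zpow_eq k
  obtain ⟨p, rfl⟩ := hu
  exact ⟨(none, p, m), by simp [bruhat, bruhatCell, hm]⟩

theorem bigCell_mem_bruhat (h : BruhatRelations x t w) (hv : v ∈ Set.range (unipotent x t))
    (hu : u ∈ Set.range (unipotent x t)) (k : ℤ) :
    v * w * (u * x ^ k) ∈ Set.range (bruhat x t w) := by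
  obtain ⟨m, hm⟩ := h.exists_zpow_eq k
  obtain ⟨p, rfl⟩ := hu
  obtain ⟨q, rfl⟩ := hv
  exact ⟨(some q, p, m), by simp [bruhat, bruhatCell, hm]⟩

theorem bruhat_cases (hg : g ∈ Set.range (bruhat x t w)) :
    ∃ u ∈ Set.range (unipotent x t), ∃ k : ℤ,
      g = u * x ^ k ∨ ∃ v ∈ Set.range (unipotent x t), g = v * w * (u * x ^ k) := by
  obtain ⟨⟨_ | q, p, k⟩, rfl⟩ := hg
  · exact ⟨_, ⟨p, rfl⟩, k.val, .inl (by simp [bruhat, bruhatCell])⟩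
  · exact ⟨_, ⟨p, rfl⟩, k.val, .inr ⟨_, ⟨q, rfl⟩, by simp [bruhat, bruhatCell]⟩⟩

theorem zpow_mul_mem_bruhat (h : BruhatRelations x t w) (n : ℤ)
    (hg : g ∈ Set.range (bruhat x t w)) : x ^ n * g ∈ Set.range (bruhat x t w) := by
  obtain ⟨u, hu, k, rfl | ⟨v, hv, rfl⟩⟩ := bruhat_cases hg
  · obtain ⟨u', hu', e⟩ := h.zpow_mul_unipotent n hu
    rw [← mul_assoc, e, mul_assoc, ← zpow_add]
    exact h.borel_mem_bruhat hu' _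
  · obtain ⟨v', hv', e⟩ := h.zpow_mul_unipotent n hv
    obtain ⟨u', hu', e'⟩ := h.zpow_mul_unipotent (-n) hu
    convert h.bigCell_mem_bruhat hv' hu' (-n + k) using 1
    calc x ^ n * (v * w * (u * x ^ k)) = x ^ n * v * w * (u * x ^ k) := by simp only [mul_assoc]
      _ = v' * (w * x ^ (-n)) * u * x ^ k := by rw [e, h.w_mul_zpow, neg_neg]; simp only [mul_assoc]
      _ = v' * w * (x ^ (-n) * u) * x ^ k := by simp only [mul_assoc]
      _ = v' * w * (u' * x ^ (-n + k)) := by rw [e', zpow_add]; simp only [mul_assoc]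

theorem unipotent_mul_mem_bruhat (h : BruhatRelations x t w)
    (hu : u ∈ Set.range (unipotent x t)) (hg : g ∈ Set.range (bruhat x t w)) :
    u * g ∈ Set.range (bruhat x t w) := by
  obtain ⟨u', hu', k, rfl | ⟨v, hv, rfl⟩⟩ := bruhat_cases hg
  · rw [← mul_assoc]
    exact h.borel_mem_bruhat (h.unipotent_mul_mem hu hu') k
  · rw [← mul_assoc, ← mul_assoc u]
    exact h.bigCell_mem_bruhat (h.unipotent_mul_mem hu hv) hu' k

theorem w_mul_mem_bruhat (h : BruhatRelations x t w) (hg : g ∈ Set.range (bruhat x t w)) :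
    w * g ∈ Set.range (bruhat x t w) := by
  obtain ⟨u, hu, k, rfl | ⟨v, hv, rfl⟩⟩ := bruhat_cases hg
  · simpa using h.bigCell_mem_bruhat one_mem_unipotent hu k
  obtain rfl | ⟨m, rfl⟩ := unipotent_cases hv
  · rw [one_mul, ← mul_assoc, h.w_mul_w, one_mul]
    exact h.borel_mem_bruhat hu k
  have ht : t ∈ Set.range (unipotent x t) := by simpa using h.conj_mem_unipotent 0
  obtain ⟨u', hu', e⟩ := h.zpow_mul_unipotent m hu
  convert h.zpow_mul_mem_bruhat (-m) (h.unipotent_mul_mem_bruhat ht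
    (h.bigCell_mem_bruhat one_mem_unipotent (h.unipotent_mul_mem ht hu') (m + k))) using 1
  calc w * (x ^ m * t * x ^ (-m) * w * (u * x ^ k))
      = w * x ^ m * t * (x ^ (-m) * w) * (u * x ^ k) := by simp only [mul_assoc]
    _ = x ^ (-m) * (w * t * w) * (x ^ m * u) * x ^ k := by
      rw [← h.w_mul_zpow m]
      nth_rw 1 [h.w_mul_zpow m]
      simp only [mul_assoc]
    _ = x ^ (-m) * (t * (1 * w * (t * u' * x ^ (m + k)))) := by
      rw [h.w_mul_t_mul_w, e, zpow_add, one_mul]; simp only [mul_assoc]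

end BruhatRelations

end BruhatDecomposition

section ProjectiveLine

/-- The projective line over the field with `32` elements. For a generator `a` of the
multiplicative group with `a ^ 5 + a ^ 2 + 1 = 0`, the elements `none`, `some none` and
`some (some k)` stand for `∞`, `0` and `a ^ k`. -/
abbrev ProjectiveLine : Type := Option (Option (Fin 31))

/-- The Zech logarithm: `1 + a ^ k = a ^ zech k` for `k ≠ 0`. -/
def zech (k : Fin 31) : Fin 31 :=
  [0, 18, 5, 29, 10, 2, 27, 22, 20, 16, 4, 19, 23, 14, 13, 24, 9, 30, 1, 11, 8, 25,
   7, 12, 15, 21, 28, 6, 26, 3, 17].getD k.val 0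

/-- The map `z ↦ a ^ c * z`. -/
def dilation (c : Fin 31) : Equiv.Perm ProjectiveLine :=
  (Equiv.addRight c).optionCongr.optionCongr

/-- The function `z ↦ z⁻¹`. -/
def inversionFun : ProjectiveLine → ProjectiveLine
  | none => some none
  | some none => none
  | some (some k) => some (some (-k))

/-- The function `z ↦ z + 1`. -/
def translationFun : ProjectiveLine → ProjectiveLine
  | none => none
  | some none => some (some 0)
  | some (some k) => if k = 0 then some none else some (some (zech k))

/-- The permutation `z ↦ z⁻¹`. -/
def inversion : Equiv.Perm ProjectiveLine where
  toFun := inversionFun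
  invFun := inversionFun
  left_inv := by decide +kernel
  right_inv := by decide +kernel

/-- The permutation `z ↦ z + 1`. -/
def translation : Equiv.Perm ProjectiveLine where
  toFun := translationFun
  invFun := translationFun
  left_inv := by decide +kernel
  right_inv := by decide +kernel

/-- The image of the second generator of `Hbar`. -/
def permY : Equiv.Perm ProjectiveLine :=
  dilation 25 * translation * dilation (-25) * inversion * dilation 29 * translation *
    dilation (-29)

theorem lift_eq_one_of_mem_Hrels : ∀ r ∈ Hrels, FreeGroup.lift ![dilation 2, permY] r = 1 := by
  simp only [Hrels, Set.mem_insert_iff, Set.mem_singleton_iff, forall_eq_or_imp, forall_eq,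
    map_mul, map_pow, map_zpow, FreeGroup.lift_apply_of, Matrix.cons_val_zero,
    Matrix.cons_val_one, Equiv.ext_iff]
  decide +kernel

/-- The action of `Hbar` on the projective line. -/
def toPerm : Hbar →* Equiv.Perm ProjectiveLine :=
  PresentedGroup.toGroup lift_eq_one_of_mem_Hrels

theorem unipotent_apply_infty :
    ∀ u, unipotent (dilation 2) translation u none = none := by
  decide +kernel

theorem unipotent_apply_zero_injective :
    Function.Injective fun u => unipotent (dilation 2) translation u (some none) := by
  decide +kernel

theorem dilation_pow_apply_infty (k : Fin 31) :
    (dilation 2 ^ k.val) none = none := by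
  decide +revert +kernel

theorem dilation_pow_apply_zero (k : Fin 31) :
    (dilation 2 ^ k.val) (some none) = some none := by
  decide +revert +kernel

theorem dilation_pow_apply_one_injective :
    Function.Injective fun k : Fin 31 => (dilation 2 ^ k.val) (some (some 0)) := by
  decide +kernel

theorem bruhatCell_apply_infty_injective :
    Function.Injective fun v => bruhatCell (dilation 2) translation inversion v none := by
  decide +kernel

theorem bruhat_injective : Function.Injective (bruhat (dilation 2) translation inversion) := by
  rintro ⟨v, u, k⟩ ⟨v', u', k'⟩ h
  simp only [bruhat] at h
  obtain rfl : v = v' := bruhatCell_apply_infty_injective <| by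
    simpa [dilation_pow_apply_infty, unipotent_apply_infty] using DFunLike.congr_fun h none
  replace h := mul_left_cancel h
  obtain rfl : u = u' := unipotent_apply_zero_injective <| by
    simpa [dilation_pow_apply_zero] using DFunLike.congr_fun h (some none)
  replace h := mul_left_cancel h
  obtain rfl : k = k' := dilation_pow_apply_one_injective (DFunLike.congr_fun h (some (some 0)))
  rfl

end ProjectiveLine

namespace Hbar

/-- The first generator of `Hbar`. -/
def x : Hbar := PresentedGroup.of 0

/-- The second generator of `Hbar`. -/
def y : Hbar := PresentedGroup.of 1

/-- A unipotent element of `Hbar`, normalized by `x`. -/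
def t : Hbar := y ^ (-2 : ℤ) * x ^ (1 : ℤ) * y ^ (-3 : ℤ) * x ^ (-15 : ℤ)

/-- An involution of `Hbar` that inverts `x`. -/
def w : Hbar := y ^ (4 : ℤ) * x ^ (-2 : ℤ) * y ^ (-5 : ℤ) * x ^ (-9 : ℤ)

theorem x_pow : x ^ 31 = 1 :=
  PresentedGroup.one_of_mem (rels := Hrels) (x := FreeGroup.of 0 ^ 31) (by simp [Hrels])

theorem y_pow : y ^ 31 = 1 :=
  PresentedGroup.one_of_mem (rels := Hrels) (x := FreeGroup.of 1 ^ 31) (by simp [Hrels])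

theorem squaresToOne : SquaresToOne x y involutionExponents := by
  refine squaresToOne_involutionExponents x_pow y_pow ?_
  simp only [SquaresToOne, List.forall_mem_cons, List.not_mem_nil, false_imp_iff, implies_true,
    and_true, zpow_one]
  exact ⟨PresentedGroup.one_of_mem (rels := Hrels)
      (x := (FreeGroup.of 0 * FreeGroup.of 1 ^ 2) ^ 2) (by simp [Hrels]),
    PresentedGroup.one_of_mem (rels := Hrels)
      (x := (FreeGroup.of 0 ^ 2 * FreeGroup.of 1) ^ 2) (by simp [Hrels]),
    PresentedGroup.one_of_mem (rels := Hrels)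
      (x := (FreeGroup.of 0 ^ 3 * FreeGroup.of 1 ^ (-11 : ℤ)) ^ 2) (by simp [Hrels]),
    PresentedGroup.one_of_mem (rels := Hrels)
      (x := (FreeGroup.of 0 ^ 4 * FreeGroup.of 1 ^ 13) ^ 2) (by simp [Hrels])⟩

theorem altProd_eq_one {l : List ℤ} {ms : List (ℕ × ℤ)} (hl : l.length % 2 = 0)
    (h : reduces (involutionExponents.map Prod.swap) l ms = true) : altProd y x l = 1 :=
  altProd_eq_one_of_reduces squaresToOne.swap y_pow x_pow hl h

theorem t_mul_t : t * t = 1 := by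
  have := altProd_eq_one (l := [-2, 1, -3, -15, -2, 1, -3, -15])
    (ms := [(0, 0), (2, 0), (7, 0), (7, 0), (7, 0), (7, 9), (3, 0), (1, 0), (7, 0), (2,
      0), (7, 4), (2, 6)]) (by simp) rfl
  simpa [altProd, t, mul_assoc] using this

theorem w_mul_w : w * w = 1 := by
  have := altProd_eq_one (l := [4, -2, -5, -9, 4, -2, -5, -9])
    (ms := [(7, 0), (7, 0), (1, 0), (1, 0), (7, 0), (1, 0), (1, -9), (5, 0), (7, 0), (7,
      0), (1, 0), (7, 0), (2, 15), (1, -12), (6, -12)]) (by simp) rfl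
  simpa [altProd, w, mul_assoc] using this

theorem w_mul_x : w * x * w * x = 1 := by
  have := altProd_eq_one (l := [4, -2, -5, -8, 4, -2, -5, -8])
    (ms := [(7, 0), (2, 0), (7, 0), (7, 0), (2, 0), (7, 0), (7, 0), (6, 0), (1, -4), (3,
      0), (1, 0), (7, 0), (2, 15), (5, -1), (6, -1)]) (by simp) rfl
  have hx : x ^ (-8 : ℤ) = x ^ (-9 : ℤ) * x := by group
  simpa only [altProd, w, mul_assoc, hx, mul_one] using this

theorem braid : t * w * t * w * t * w = 1 := by
  have := altProd_eq_one
    (l := [-2, 1, -3, -15, 4, -2, -5, -9, -2, 1, -3, -15, 4, -2, -5, -9, -2, 1, -3, -15,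
      4, -2, -5, -9])
    (ms := [(23, 0), (2, 0), (23, 0), (23, 0), (21, 0), (1, 0), (1, 14), (3, 0), (22, 8),
      (20, 0), (1, 0), (1, 0), (3, 13), (22, 13), (21, 0), (1, 0), (5, 9), (22, 9),
      (22, 9), (18, 0), (1, 0), (1, 0), (23, 0), (1, 0), (1, 10), (1, 2), (22, 0),
      (23, 0), (1, 0), (9, 4), (22, 4), (18, 4), (2, 4), (2, 4), (16, 0), (23, 0),
      (1, 0), (23, 0), (1, 0), (1, 12), (16, 0), (1, 0), (1, 0), (2, 0), (23, 0),
      (1, 0), (1, -8), (20, 0), (1, 0), (23, 0), (23, 0), (1, 0), (1, 0), (1, -13),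
      (22, 0), (23, 0), (23, 0), (23, 0), (1, 0), (23, 0), (1, 0), (1, 1), (22, 0),
      (1, 5), (2, 5), (21, -2), (2, -2), (2, -2), (2, -2), (2, -2)]) (by simp) rfl
  simpa only [altProd, t, w, mul_assoc, mul_one] using this

/-- Triples `(a, b, c)` of exponents for which `t * x ^ a * t * x ^ b * t * x ^ c = 1`. Up to sign
and modulo `31`, their entries are all the nonzero residues. -/
def lineExponents : List (ℤ × ℤ × ℤ) :=
  [(2, 3, -5), (9, 7, 15), (10, -6, -4), (12, 11, 8), (13, 1, -14)]

theorem line_relation :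
    ∀ p ∈ lineExponents, t * x ^ p.1 * t * x ^ p.2.1 * t * x ^ p.2.2 = 1 := by
  have of_altProd {a b c : ℤ}
      (h : altProd y x [-2, 1, -3, -15 + a, -2, 1, -3, -15 + b, -2, 1, -3, -15 + c] = 1) :
      t * x ^ a * t * x ^ b * t * x ^ c = 1 := by
    simpa only [altProd, t, zpow_add, mul_assoc, mul_one] using h
  simp only [lineExponents, List.forall_mem_cons, List.not_mem_nil, false_imp_iff, implies_true,
    and_true]
  refine ⟨?_, ?_, ?_, ?_, ?_⟩
  · exact of_altProd <| altProd_eq_one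
      (ms := [(10, 0), (4, 0), (1, 0), (1, -3), (8, 0), (9, -1), (4, 0), (1, 0), (9, 0),
        (1, 0), (11, 0), (1, 0), (1, 5), (2, -12), (2, -12), (3, 2), (2, 2)]) (by simp) rfl
  · exact of_altProd <| altProd_eq_one
      (ms := [(10, -2), (5, 0), (1, 0), (11, 0), (1, 0), (11, 0), (1, 0), (1, 0), (1, 0),
        (1, 0), (1, -5), (7, 0), (1, 0), (1, 12), (9, 0), (11, 0), (2, 0), (11, 2),
        (2, -7), (2, -7)]) (by simp) rfl
  · exact of_altProd <| altProd_eq_one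
      (ms := [(5, 0), (1, 0), (1, 1), (10, 0), (11, 0), (11, 0), (11, 0), (1, 0), (1, 0),
        (1, -15), (6, 0), (1, 0), (1, 0), (1, -15), (9, 0), (1, 0), (10, 0), (1,
        11), (2, 12), (2, 12)]) (by simp) rfl
  · exact of_altProd <| altProd_eq_one
      (ms := [(4, 0), (1, 0), (11, 0), (4, 0), (11, 0), (11, 0), (2, 0), (11, 0), (10,
        6), (4, 0), (11, -2), (5, 0), (1, 0), (1, -10), (8, 0), (1, 0), (11, 0), (2,
        0), (11, -13), (10, 1)]) (by simp) rfl
  · exact of_altProd <| altProd_eq_one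
      (ms := [(3, 0), (4, 0), (11, 0), (11, 0), (1, 0), (10, 2), (6, 0), (11, 0), (11,
        0), (3, 0), (8, 11), (7, 0), (8, 5), (3, 0), (11, 0), (1, 0), (11, 0), (2,
        6), (9, -5), (10, -5)]) (by simp) rfl

theorem y_eq : y = x ^ (28 : ℤ) * t * x ^ (-28 : ℤ) * w * x ^ (30 : ℤ) * t * x ^ (-30 : ℤ) := by
  have := altProd_eq_one (l := [-2, 1, -3, -43, 4, -2, -5, 21, -2, 1, -3, -45, -1, 28])
    (ms := [(12, 0), (1, 0), (12, 0), (1, 0), (13, 0), (13, 0), (13, 0), (13, 2), (8, 0),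
      (9, 0), (6, 0), (7, 4), (6, 0), (1, 0), (1, -5), (11, 0), (13, 0), (1, 0), (1,
      -2), (11, 0), (1, 0), (12, 0), (1, -4), (8, 10), (2, 10), (2, 10)]) (by simp) rfl
  have hy : t * x ^ (-28 : ℤ) * w * x ^ (30 : ℤ) * t * x ^ (-30 : ℤ) * y⁻¹ * x ^ (28 : ℤ) = 1 := by
    have h₁ : x ^ (-43 : ℤ) = x ^ (-15 : ℤ) * x ^ (-28 : ℤ) := by group
    have h₂ : x ^ (21 : ℤ) = x ^ (-9 : ℤ) * x ^ (30 : ℤ) := by group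
    have h₃ : x ^ (-45 : ℤ) = x ^ (-15 : ℤ) * x ^ (-30 : ℤ) := by group
    simpa only [altProd, t, w, h₁, h₂, h₃, mul_assoc, mul_one, zpow_neg_one] using this
  calc y = x ^ (28 : ℤ) * (t * x ^ (-28 : ℤ) * w * x ^ (30 : ℤ) * t * x ^ (-30 : ℤ) * y⁻¹ *
        x ^ (28 : ℤ)) * x ^ (-28 : ℤ) * y := by rw [hy]; group
    _ = _ := by group

theorem t_mul_conj (k : ℤ) (hk : ¬ 31 ∣ k) :
    ∃ m : ℤ, t * (x ^ k * t * x ^ (-k)) = x ^ m * t * x ^ (-m) := by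
  have ht : t⁻¹ = t := inv_eq_of_mul_eq_one_left t_mul_t
  have of_relation {a b c : ℤ} (h : t * x ^ a * t * x ^ b * t * x ^ c = 1)
      (habc : (a + b + c) % 31 = 0) (hk : (k - a) % 31 = 0 ∨ (k + a) % 31 = 0) :
      ∃ m : ℤ, t * (x ^ k * t * x ^ (-k)) = x ^ m * t * x ^ (-m) := by
    obtain hk | hk := hk
    · refine ⟨-c, ?_⟩
      have h' : t * x ^ a * t = x ^ (-c) * t * x ^ (-b) := by
        calc t * x ^ a * t
            = t * x ^ a * t * x ^ b * t * x ^ c * x ^ (-c) * t⁻¹ * x ^ (-b) := by group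
          _ = x ^ (-c) * t * x ^ (-b) := by rw [h, ht, one_mul]
      rw [zpow_neg x k, zpow_eq_zpow_of_emod x_pow hk, ← mul_assoc, ← mul_assoc, h', ← zpow_neg,
        mul_assoc _ (x ^ (-b)), ← zpow_add,
        zpow_eq_zpow_of_emod x_pow (a := -b + -a) (b := - -c) (by omega)]
    · refine ⟨b, ?_⟩
      have h' : t * x ^ (-a) * t = x ^ b * t * x ^ c := by
        calc t * x ^ (-a) * t = t⁻¹ * x ^ (-a) * t⁻¹ := by rw [ht]
          _ = t⁻¹ * x ^ (-a) * t⁻¹ * (t * x ^ a * t * x ^ b * t * x ^ c) := by rw [h, mul_one]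
          _ = x ^ b * t * x ^ c := by group
      rw [zpow_neg x k, zpow_eq_zpow_of_emod x_pow (a := k) (b := -a) (by omega), ← mul_assoc,
        ← mul_assoc, h', ← zpow_neg, mul_assoc _ (x ^ c), ← zpow_add,
        zpow_eq_zpow_of_emod x_pow (a := c + - -a) (b := -b) (by omega)]
  have rotate {a b c : ℤ} (h : t * x ^ a * t * x ^ b * t * x ^ c = 1) :
      t * x ^ b * t * x ^ c * t * x ^ a = 1 := by
    calc t * x ^ b * t * x ^ c * t * x ^ a
        = (t * x ^ a)⁻¹ * (t * x ^ a * t * x ^ b * t * x ^ c) * (t * x ^ a) := by group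
      _ = 1 := by rw [h]; group
  have cover : ∀ r ∈ Finset.Icc (1 : ℤ) 30, ∃ p ∈ lineExponents,
      (p.1 + p.2.1 + p.2.2) % 31 = 0 ∧
      (((r - p.1) % 31 = 0 ∨ (r + p.1) % 31 = 0) ∨
      ((r - p.2.1) % 31 = 0 ∨ (r + p.2.1) % 31 = 0) ∨
      ((r - p.2.2) % 31 = 0 ∨ (r + p.2.2) % 31 = 0)) := by
    decide +kernel
  obtain ⟨⟨a, b, c⟩, hp, habc, hr⟩ := cover (k % 31) (Finset.mem_Icc.2 (by omega))
  have h := line_relation _ hp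
  dsimp only at habc hr h
  obtain hr | hr | hr := hr
  · exact of_relation h habc (by omega)
  · exact of_relation (rotate h) (by omega) (by omega)
  · exact of_relation (rotate (rotate h)) (by omega) (by omega)

theorem bruhatRelations : BruhatRelations x t w :=
  ⟨x_pow, t_mul_t, w_mul_w, w_mul_x, braid, t_mul_conj⟩

theorem bruhat_surjective : Function.Surjective (bruhat x t w) := by
  have h := bruhatRelations
  have ht : t ∈ Set.range (unipotent x t) := by simpa using h.conj_mem_unipotent 0
  have t_mul {g : Hbar} (hg : g ∈ Set.range (bruhat x t w)) :=
    h.unipotent_mul_mem_bruhat ht hg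
  have hw : w⁻¹ = w := inv_eq_of_mul_eq_one_left w_mul_w
  have ht' : t⁻¹ = t := inv_eq_of_mul_eq_one_left t_mul_t
  have mem (g : Hbar) : g ∈ Subgroup.closure (Set.range (PresentedGroup.of (rels := Hrels))) := by
    rw [PresentedGroup.closure_range_of]; trivial
  intro g
  induction mem g using Subgroup.closure_induction_left with
  | one => exact ⟨(none, none, 0), by simp [bruhat, bruhatCell, unipotent]⟩
  | mul_left z hz g _ ih =>
    obtain ⟨i, rfl⟩ := hz
    fin_cases i
    · change x * g ∈ Set.range _
      simpa only [zpow_one] using h.zpow_mul_mem_bruhat 1 ih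
    · change y * g ∈ Set.range _
      rw [y_eq]
      simp only [mul_assoc]
      exact h.zpow_mul_mem_bruhat _ <| t_mul <| h.zpow_mul_mem_bruhat _ <| h.w_mul_mem_bruhat <|
        h.zpow_mul_mem_bruhat _ <| t_mul <| h.zpow_mul_mem_bruhat _ ih
  | inv_mul_cancel z hz g _ ih =>
    obtain ⟨i, rfl⟩ := hz
    fin_cases i
    · change x⁻¹ * g ∈ Set.range _
      simpa only [zpow_neg_one] using h.zpow_mul_mem_bruhat (-1) ih
    · change y⁻¹ * g ∈ Set.range _
      rw [y_eq]
      simp only [mul_inv_rev, ← zpow_neg, mul_assoc, ht', hw]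
      exact h.zpow_mul_mem_bruhat _ <| t_mul <| h.zpow_mul_mem_bruhat _ <| h.w_mul_mem_bruhat <|
        h.zpow_mul_mem_bruhat _ <| t_mul <| h.zpow_mul_mem_bruhat _ ih

theorem toPerm_x : toPerm x = dilation 2 := PresentedGroup.toGroup.of _

theorem toPerm_y : toPerm y = permY := PresentedGroup.toGroup.of _

theorem toPerm_t : toPerm t = translation := by
  simp only [t, map_mul, map_zpow, toPerm_x, toPerm_y, Equiv.ext_iff]
  decide +kernel

theorem toPerm_w : toPerm w = inversion := by
  simp only [w, map_mul, map_zpow, toPerm_x, toPerm_y, Equiv.ext_iff]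
  decide +kernel

theorem bruhat_injective : Function.Injective (bruhat x t w) := by
  have map_unipotent (u) : toPerm (unipotent x t u) = unipotent (dilation 2) translation u := by
    cases u <;> simp [unipotent, toPerm_x, toPerm_t]
  have map_bruhatCell (v) :
      toPerm (bruhatCell x t w v) = bruhatCell (dilation 2) translation inversion v := by
    cases v <;> simp [bruhatCell, map_unipotent, toPerm_w]
  refine Function.Injective.of_comp (f := toPerm) ?_
  convert _root_.bruhat_injective using 1
  ext1 p
  simp [bruhat, map_bruhatCell, map_unipotent, toPerm_x]

end Hbar

/-- H̄ is finite of order 32736. -/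
theorem Hbar_order : Nat.card Hbar = 32736 := by
  rw [← Nat.card_congr (Equiv.ofBijective _ ⟨Hbar.bruhat_injective, Hbar.bruhat_surjective⟩)]
  simp
end

section
/- Let H̄ be the group with presentation ⟨x, y | x^{31} = 1, y^{31} = 1, (x^2y)^2 = 1, (xy^2)^2 = 1, (x^3y^{-11})^2 = 1, (x^4y^{13})^2 = 1⟩. Then the index of the cyclic subgroup generated by x in H̄ is 1056. -/
/-! ### Coset enumeration

The upper bound on the index is a Todd-Coxeter enumeration of the cosets of `⟨x⟩` with respect to
the generators `x` and `a = x ^ 2 * y`. The order of `x` is built in: the number `31 * i + k` names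
the point `x ^ k • φ i`, where `φ` labels the blocks of 31 points. -/

namespace CosetEnumeration

/-- A table of natural numbers indexed by natural numbers; absent entries are `0`. -/
inductive Table
  | nil
  | node (v : ℕ) (l r : Table)

namespace Table

/-- The empty table with room for the indices below `2 ^ d - 1`. -/
def blank : ℕ → Table
  | 0 => nil
  | d + 1 => node 0 (blank d) (blank d)

/-- The entry at an index. -/
def get : Table → ℕ → ℕ
  | nil, _ => 0
  | node v l r, n =>
    bif n.beq 0 then v else bif (n % 2).beq 1 then l.get (n / 2) else r.get (n / 2 - 1)

/-- Overwrite the entry at an index. -/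
def set : Table → ℕ → ℕ → Table
  | nil, _, _ => nil
  | node v l r, n, w =>
    bif n.beq 0 then node w l r
    else bif (n % 2).beq 1 then node v (l.set (n / 2) w) r else node v l (r.set (n / 2 - 1) w)

theorem get_blank (d n : ℕ) : (blank d).get n = 0 := by
  induction d generalizing n with
  | zero => rfl
  | succ d ih => simp [blank, get, ih]

theorem get_set (t : Table) (n w m : ℕ) :
    (t.set n w).get m = t.get m ∨ m = n ∧ (t.set n w).get m = w := by
  induction t generalizing n m with
  | nil => exact .inl rfl
  | node v l r ihl ihr =>
    have hl := ihl (n / 2) (m / 2)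
    have hr := ihr (n / 2 - 1) (m / 2 - 1)
    simp only [set, Bool.cond_eq_ite, Nat.beq_eq]
    split_ifs with h0 h1 <;> simp only [get, Bool.cond_eq_ite, Nat.beq_eq] <;>
      split_ifs <;> grind

end Table

/-- An enumeration in progress: `par` identifies points, `act` records the action of `a`.
An entry `p + 1` stands for the point `p`. -/
structure State where
  par : Table
  act : Table

/-- Move the point `p` by `x ^ e`. -/
def shift (p e : ℕ) : ℕ := p - p % 31 + (p % 31 + e) % 31

/-- Follow the identifications recorded in a table, at most `fuel` times. -/
def find (t : Table) : (fuel : ℕ) → ℕ → ℕ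
  | 0, p => p
  | fuel + 1, p => match t.get p with
    | 0 => p
    | q + 1 => find t fuel q

namespace State

/-- The representative of a point. -/
def root (s : State) (p : ℕ) : ℕ := find s.par 10 p

/-- Record that `a` sends `p` to `q`, identifying `q` with the known image of `p` if there is one. -/
def record (merge : State → ℕ → ℕ → State) (s : State) (p q : ℕ) : State :=
  match s.act.get p with
  | 0 => { s with act := s.act.set p (q + 1) }
  | t + 1 => merge s t q

/-- Identify two points and all the points that then coincide as well. -/
def merge : (fuel : ℕ) → State → ℕ → ℕ → State
  | 0, s, _, _ => s
  | fuel + 1, s, p, q =>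
    let p' := s.root p
    let q' := s.root q
    bif p'.beq q' then s else
    let p := bif p'.ble q' then p' else q'
    let q := bif p'.ble q' then q' else p'
    let s' : State := { s with par := s.par.set q (p + 1) }
    let s'' := match s.act.get q with
      | 0 => s'
      | t + 1 => s'.record (merge fuel) p t
    merge fuel s'' (shift p 1) (shift q 1)

/-- Record that `a` exchanges `p` and `q`. -/
def link (s : State) (p q : ℕ) : State :=
  let s' := s.record (merge 200) (s.root p) (s.root q)
  s'.record (merge 200) (s'.root q) (s'.root p)

/-- Trace a relator from `f`, where it has to end at `p`, and deduce its last edge.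
The list `[e₀, e₁, …]` stands for the word `a, x ^ e₀, a, x ^ e₁, …`. -/
def trace (s : State) (p : ℕ) : List ℕ → ℕ → State
  | [], _ => s
  | [e], f => s.link f (shift p (30 * e))
  | e :: es, f => match s.act.get f with
    | 0 => s
    | t + 1 => s.trace p es (s.root (shift t e))

/-- Start a new block of points at the `a`-image of each of the given points. -/
def define : List ℕ → (i : ℕ) → State → State
  | [], _, s => s
  | d :: ds, i, s => define ds (i + 1) (bif (d / 31).ble i then s.link d (31 * (i + 1)) else s)

/-- Trace relators from points; `27 * p + r` refers to the point `p` and relator number `r`. -/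
def deduce (W : List (List ℕ)) : List ℕ → State → State
  | [], s => s
  | n :: ns, s => deduce W ns (s.trace (n / 27) (W.getD (n % 27) []) (s.root (n / 27)))

/-- `p` is a representative below `N`. -/
def good (s : State) (N p : ℕ) : Bool := p.blt N && (s.par.get p).beq 0

/-- All representatives below `N` have images under `x` and `a`, and there are at most `c` of them. -/
def closed (s : State) (N c : ℕ) : Bool :=
  s.good N (s.root 0) &&
  (List.range N).all (fun p => !s.good N p || (s.good N (s.root (shift p 1)) &&
    match s.act.get p with
    | 0 => false
    | t + 1 => s.good N (s.root t))) &&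
  ((List.range N).countP (s.good N)).ble c

end State

/-- The four relators, in terms of `x` and `a`, that do not merely give the orders of `x` and `a`,
in all their rotations. -/
def relators : List (List ℕ) :=
  [List.replicate 31 29, [29, 30, 29, 30], [30, 29, 30, 29]] ++
  (List.range 11).map (List.replicate 10 29 ++ 26 :: (List.replicate 10 29 ++ [26])).rotate ++
  (List.range 13).map (List.replicate 12 29 ++ 2 :: (List.replicate 12 29 ++ [2])).rotate

/-- The points at whose `a`-images new blocks are started. -/
def definitions : List ℕ := [
  0, 33, 45, 123, 48, 156, 43, 56, 37, 61, 57, 50, 42, 44, 282, 36, 491, 39, 41, 35, 55, 52, 676,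
  446, 674, 398, 559, 843, 840, 705, 591, 58, 929, 40, 392, 743, 69, 457, 83, 673, 595, 34, 991,
  989, 53, 54, 1331, 65, 374, 594, 1391, 448, 783, 596, 597, 453, 709, 593, 1021, 1095, 856, 1329,
  459, 458, 1328, 1763, 710, 67, 848, 1766, 2140, 445, 456, 449, 1145, 2264, 1630, 1952, 1311,
  450, 706, 851, 1312, 2510, 1397, 1768, 447, 1492, 442, 523, 2541, 1503, 396, 98, 2543, 1319,
  1496, 1983, 2729, 1314, 452, 1493, 2562, 3194, 1309, 1509, 1494, 68, 869, 2567, 672, 2016, 2554,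
  3223, 3342, 1499, 1325, 1513, 2109, 2853, 3533, 1306, 444, 1307, 1313, 1326, 397, 2169, 1507,
  845, 846, 2450, 2572, 898, 1495, 1508, 4228, 2043, 3256, 395, 3011, 2176, 1514]

/-- The deductions, in order. -/
def deductions : List ℕ := [
  838, 1675, 25948, 39340, 48547, 71146, 84538, 108811, 16742, 18254, 22601, 59429, 93746, 99605,
  110486, 116345, 1647, 35155, 16741, 66070, 52706, 13393, 93745, 106274, 98745, 7534, 27568,
  50167, 974, 1567, 1702, 24274, 28459, 40177, 1730, 22655, 27596, 40178, 82865, 91235, 15904,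
  90397, 10019, 15932, 22682, 22736, 40205, 10882, 30970, 41851, 85375, 89560, 109648, 112996,
  7508, 18389, 22817, 22871, 39314, 79517, 40190, 5860, 11719, 34318, 45199, 46036, 81190, 94582,
  97093, 107974, 22898, 22952, 38477, 40394, 71147, 87050, 99632, 112133, 120503, 19228, 35207,
  2512, 11611, 1190, 5024, 11612, 40448, 40475, 56891, 100442, 10869, 11799, 5887, 11800, 41014,
  41041, 71983, 72010, 76951, 102115, 103789, 1217, 35264, 35318, 40502, 40556, 40610, 68609,
  69472, 104626, 113833, 83701, 88723, 92071, 74506, 10868, 99576, 11881, 74494, 98794, 5888,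
  35453, 35480, 114645, 2539, 88750, 114670, 22574, 107111, 82810, 102952, 53543, 54380, 78653,
  117995, 18307, 60265, 63532, 18308, 32618, 30120, 6724, 20089, 30916, 63613, 63640, 72820,
  89641, 89644, 43525, 59374, 61939, 66961, 12125, 47684, 62762, 25926, 71130, 22613, 23396,
  12205, 15094, 17659, 46009, 92908, 15095, 16175, 16202, 20063, 51869, 33481, 21737, 53555,
  79529, 1014, 28486, 82027, 35670, 44337, 96204, 113808, 51871, 81166, 12568, 64450, 103816,
  110377, 110404, 118855, 1838, 1865, 1892, 59456, 118856, 88698, 110487, 111349, 91273, 25016,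
  40852, 118018, 32619, 74469, 86214, 117156, 18914, 22505, 55243, 92935, 118045, 30135, 42663,
  49359, 99579, 24125, 1743, 86390, 1864, 16795, 47737, 56944, 78679, 78680, 31755, 6710, 105449,
  7602, 63600, 24046, 1810, 10963, 34345, 66205, 9209, 9236, 16418, 16445, 16472, 16499, 10966,
  33457, 32683, 11624, 25989, 6589, 25975, 26029, 29188, 41068, 84592, 1919, 1946, 1973, 23438,
  32699, 38478, 29191, 29201, 1986, 23465, 23492, 23519, 37642, 76156, 946, 24355, 51004, 32700,
  24358, 14230, 14257, 15715, 32833, 13178, 116327, 8357, 51055, 11557, 94501, 32969, 7509, 33024,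
  33000, 50232, 116330, 105370, 28511, 13366, 28540, 28783, 83728, 97039, 38532, 76926, 118857,
  97070, 62815, 93731, 13987, 15742, 24409, 60292, 33212, 33239, 33266, 33293, 33320, 88753,
  62837, 2525, 70295, 110390, 28959, 45456, 118059, 69568, 92123, 4240, 21088, 44362, 45496,
  69553, 74548, 79435, 80380, 92827, 110323, 2000, 2027, 4160, 10991, 15122, 15149, 15176, 65262,
  76116, 80382, 3352, 83731, 44375, 102047, 105368, 13731, 74562, 3241, 3403, 15229, 16552, 64612,
  70957, 74602, 96310, 11018, 56919, 70960, 74605, 96313, 84596, 44376, 84671, 2242, 36910, 46144,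
  57592, 65125, 65179, 15230, 28541, 28568, 78843, 28597, 36913, 45823, 46147, 84298, 76237,
  52462, 84295, 84700, 76196, 51897, 76224, 76359, 76360, 84703, 21668, 63572, 87008, 110228,
  21669, 64626, 76425, 76560, 86469, 36952, 60307, 16838, 16894, 64690, 45170, 3646, 11287, 16444,
  16822, 16876, 21655, 48709, 49276, 51085, 51112, 63046, 63451, 69526, 76357, 76546, 76600,
  84754, 86455, 86509, 2621, 2648, 7076, 7103, 7130, 7157, 16904, 16931, 70337, 75494, 83756,
  2649, 16905, 21306, 25869, 51060, 56946, 70446, 70527, 76602, 3649, 36832, 36859, 36967, 36994,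
  52006, 52033, 70555, 3677, 25466, 48988, 11300, 14243, 16727, 17483, 35114, 51827, 55958, 75263,
  25530, 13246, 24424, 51316, 74671, 44432, 51290, 55313, 74645, 16569, 37332, 51941, 37308,
  55887, 14311, 14905, 25462, 25516, 25570, 25678, 25732, 44416, 51652, 52084, 55297, 75142,
  75196, 75547, 81298, 25139, 51329, 3648, 3864, 3891, 37290, 37317, 37344, 44931, 45579, 51276,
  51303, 51330, 51357, 51384, 52005, 2056, 37453, 37480, 37507, 74686]

/-- The result of the enumeration. -/
def final : State :=
  State.deduce relators deductions <| State.define definitions 0 <|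
    State.merge 200 ⟨.blank 13, .blank 13⟩ 0 1

theorem closed_final : final.closed 4464 1056 = true := by
  decide +kernel

section Soundness

variable {G Ω : Type*} [Group G] [MulAction G Ω]

/-- The point named by `p` when `φ` labels the blocks. -/
def point (x : G) (φ : ℕ → Ω) (p : ℕ) : Ω := x ^ (p % 31) • φ (p / 31)

/-- All entries of the tables are true. -/
structure Sound (x a : G) (φ : ℕ → Ω) (s : State) : Prop where
  par : ∀ p q, s.par.get p = q + 1 → point x φ p = point x φ q
  act : ∀ p q, s.act.get p = q + 1 → a • point x φ p = point x φ q

variable {x a : G} {φ : ℕ → Ω} {s : State}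

theorem point_shift (hx : x ^ 31 = 1) (p e : ℕ) :
    point x φ (shift p e) = x ^ e • point x φ p := by
  have h1 : shift p e % 31 = (p % 31 + e) % 31 := by unfold shift; omega
  have h2 : shift p e / 31 = p / 31 := by unfold shift; omega
  rw [point, point, h1, h2, smul_smul, ← pow_add, ← pow_mod_orderOf x ((p % 31 + e) % 31),
    Nat.mod_mod_of_dvd _ (orderOf_dvd_of_pow_eq_one hx), pow_mod_orderOf, add_comm]

theorem Sound.point_root (h : Sound x a φ s) (p : ℕ) :
    point x φ (s.root p) = point x φ p := by
  unfold State.root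
  generalize 10 = n
  induction n generalizing p with
  | zero => rfl
  | succ n ih =>
    rw [find]
    split
    · rfl
    · next q hq => rw [ih, h.par p q hq]

theorem Sound.set_par (h : Sound x a φ s) {p q : ℕ} (hpq : point x φ p = point x φ q) :
    Sound x a φ { s with par := s.par.set p (q + 1) } := by
  refine ⟨fun m n hmn => ?_, h.act⟩
  rcases s.par.get_set p (q + 1) m with h' | ⟨rfl, h'⟩
  · exact h.par m n (h' ▸ hmn)
  · obtain rfl : q = n := by simpa [h'] using hmn
    exact hpq

theorem Sound.set_act (h : Sound x a φ s) {p q : ℕ} (hpq : a • point x φ p = point x φ q) :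
    Sound x a φ { s with act := s.act.set p (q + 1) } := by
  refine ⟨h.par, fun m n hmn => ?_⟩
  rcases s.act.get_set p (q + 1) m with h' | ⟨rfl, h'⟩
  · exact h.act m n (h' ▸ hmn)
  · obtain rfl : q = n := by simpa [h'] using hmn
    exact hpq

theorem Sound.record {merge : State → ℕ → ℕ → State}
    (hm : ∀ s p q, Sound x a φ s → point x φ p = point x φ q → Sound x a φ (merge s p q))
    (h : Sound x a φ s) {p q : ℕ} (hpq : a • point x φ p = point x φ q) :
    Sound x a φ (s.record merge p q) := by
  unfold State.record
  split
  · exact h.set_act hpq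
  · next t ht => exact hm _ _ _ h ((h.act p t ht).symm.trans hpq)

theorem Sound.merge (hx : x ^ 31 = 1) (fuel : ℕ) (s : State) (p q : ℕ) (h : Sound x a φ s)
    (hpq : point x φ p = point x φ q) : Sound x a φ (s.merge fuel p q) := by
  induction fuel generalizing s p q with
  | zero => exact h
  | succ fuel ih =>
    have key : ∀ p q, point x φ p = point x φ q → Sound x a φ
        (State.merge fuel (match s.act.get q with
          | 0 => { s with par := s.par.set q (p + 1) }
          | t + 1 => State.record (State.merge fuel) { s with par := s.par.set q (p + 1) } p t)
          (shift p 1) (shift q 1)) := by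
      intro p q hpq
      refine ih _ _ _ ?_ (by rw [point_shift hx, point_shift hx, hpq])
      split
      · exact h.set_par hpq.symm
      · next t ht => exact (h.set_par hpq.symm).record ih (hpq ▸ h.act q t ht)
    have hr : point x φ (s.root p) = point x φ (s.root q) := by
      rw [h.point_root, h.point_root, hpq]
    rw [State.merge]
    dsimp only
    cases (s.root p).beq (s.root q)
    · cases (s.root p).ble (s.root q)
      · exact key _ _ hr.symm
      · exact key _ _ hr
    · exact h

theorem Sound.link (hx : x ^ 31 = 1) (ha : a * a = 1) (h : Sound x a φ s) {p q : ℕ}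
    (hpq : a • point x φ p = point x φ q) : Sound x a φ (s.link p q) := by
  have h' : Sound x a φ (s.record (State.merge 200) (s.root p) (s.root q)) :=
    h.record (Sound.merge hx 200) (by rw [h.point_root, h.point_root, hpq])
  refine h'.record (Sound.merge hx 200) ?_
  rw [h'.point_root, h'.point_root, ← hpq, smul_smul, ha, one_smul]

/-- The inverse of the group element by which a word acts. -/
def wordInv (x a : G) (w : List ℕ) : G := (w.map fun e => (x ^ e * a)⁻¹).prod

theorem wordInv_rotate {w : List ℕ} (hw : wordInv x a w = 1) (n : ℕ) :
    wordInv x a (w.rotate n) = 1 := by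
  rw [wordInv, List.map_rotate]
  exact List.prod_rotate_eq_one_of_prod_eq_one hw n

theorem Sound.trace (hx : x ^ 31 = 1) (ha : a * a = 1) (h : Sound x a φ s) {p : ℕ} (w : List ℕ)
    (f : ℕ) (hf : point x φ f = wordInv x a w • point x φ p) :
    Sound x a φ (s.trace p w f) := by
  induction w generalizing f with
  | nil => exact h
  | cons e es ih =>
    have hf' : x ^ e • a • point x φ f = wordInv x a es • point x φ p := by
      rw [hf, wordInv, List.map_cons, List.prod_cons, mul_smul, smul_smul, smul_inv_smul]
      rfl
    cases es with
    | nil =>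
      refine h.link hx ha ?_
      rw [point_shift hx, ← one_smul G (point x φ p)]
      change x ^ e • a • point x φ f = (1 : G) • point x φ p at hf'
      rw [← hf', smul_smul (x ^ (30 * e)), ← pow_add, show 30 * e + e = 31 * e by ring, pow_mul, hx,
        one_pow, one_smul]
    | cons e' es =>
      rw [State.trace]
      · split
        · exact h
        · next t ht =>
          refine ih _ ?_
          rw [h.point_root, point_shift hx, ← h.act f t ht, hf']
      · simp

theorem Sound.define (hx : x ^ 31 = 1) (ha : a * a = 1) (ds : List ℕ) (i : ℕ)
    (hds : ∀ j d, ds[j]? = some d → d / 31 ≤ i + j → a • point x φ d = φ (i + j + 1))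
    (h : Sound x a φ s) : Sound x a φ (s.define ds i) := by
  induction ds generalizing i s with
  | nil => exact h
  | cons d ds ih =>
    refine ih (i + 1) (fun j d' hj hd' => ?_) ?_
    · rw [show i + 1 + j = i + (j + 1) by ring] at hd' ⊢
      exact hds (j + 1) d' (by simpa using hj) hd'
    · cases hle : (d / 31).ble i
      · exact h
      · refine h.link hx ha ?_
        rw [hds 0 d rfl (Nat.le_of_ble_eq_true hle)]
        simp [point]

theorem Sound.deduce (hx : x ^ 31 = 1) (ha : a * a = 1) {W : List (List ℕ)}
    (hW : ∀ w ∈ W, wordInv x a w = 1) (ns : List ℕ) (h : Sound x a φ s) :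
    Sound x a φ (s.deduce W ns) := by
  induction ns generalizing s with
  | nil => exact h
  | cons n ns ih =>
    refine ih (h.trace hx ha _ _ ?_)
    rw [h.point_root]
    rcases lt_or_ge (n % 27) W.length with hn | hn
    · rw [List.getD_eq_getElem _ _ hn, hW _ (List.getElem_mem hn), one_smul]
    · rw [List.getD_eq_default _ _ hn]
      exact (one_smul G _).symm

/-- The labelling of the blocks in which block `i + 1` starts at the `a`-image of the `i`-th of the
given points. -/
def label (x a : G) (ω : Ω) (d : ℕ → ℕ) : ℕ → Ω
  | 0 => ω
  | i + 1 => if d i / 31 ≤ i then a • x ^ (d i % 31) • label x a ω d (d i / 31) else ω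
decreasing_by omega

/-- The result of the enumeration is sound for every group in which the relators hold. -/
theorem exists_sound_final (hx : x ^ 31 = 1) (ha : a * a = 1)
    (hW : ∀ w ∈ relators, wordInv x a w = 1) {ω : Ω} (hω : x • ω = ω) :
    ∃ φ : ℕ → Ω, φ 0 = ω ∧ Sound x a φ final := by
  set φ := label x a ω (definitions.getD · 0) with hφ
  have h0 : φ 0 = ω := by rw [hφ, label]
  have hblank : Sound x a φ ⟨.blank 13, .blank 13⟩ := by
    constructor <;> simp [Table.get_blank]
  refine ⟨φ, h0, .deduce hx ha hW _ (.define hx ha _ _ (fun j d hj hd => ?_) ?_)⟩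
  · rw [zero_add] at hd ⊢
    have hj' : definitions.getD j 0 = d := by simp [List.getD, hj]
    rw [hφ, label, hj', if_pos hd, point]
  · exact hblank.merge hx 200 _ 0 1 (by simp [point, h0, hω])

open scoped Pointwise in
/-- If the tables are sound and closed, the orbit of the base point is small. -/
theorem Sound.orbit_card_le (h : Sound x a φ s) (hx : x ^ 31 = 1) {N c : ℕ}
    (hs : s.closed N c = true) (hgen : Subgroup.closure {x, a} = ⊤) :
    (MulAction.orbit G (φ 0)).Finite ∧ (MulAction.orbit G (φ 0)).ncard ≤ c := by
  classical
  simp only [State.closed, Bool.and_eq_true, List.all_eq_true, List.mem_range, Bool.or_eq_true,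
    Bool.not_eq_true'] at hs
  obtain ⟨⟨hbase, hstep⟩, hcount⟩ := hs
  have hlt : ∀ p, s.good N p = true → p < N := fun p hp => by
    simp only [State.good, Bool.and_eq_true, Nat.blt_eq] at hp
    exact hp.1
  let L := (List.range N).filter (s.good N)
  let S : Finset Ω := (L.map (point x φ)).toFinset
  have hS : ∀ p, s.good N p = true → point x φ p ∈ S := fun p hp => by
    simp only [S, L, List.mem_toFinset, List.mem_map, List.mem_filter, List.mem_range]
    exact ⟨p, ⟨hlt p hp, hp⟩, rfl⟩
  have hS' : ∀ g : G, (∀ p, s.good N p = true → g • point x φ p ∈ S) →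
      g ∈ MulAction.stabilizer G (S : Set Ω) := fun g hg => by
    rw [MulAction.mem_stabilizer_set_iff_smul_set_subset S.finite_toSet]
    rintro _ ⟨ω, hω, rfl⟩
    simp only [S, L, List.coe_toFinset, List.mem_map, List.mem_filter, Set.mem_ofPred_eq] at hω
    obtain ⟨p, ⟨_, hp⟩, rfl⟩ := hω
    exact hg p hp
  have htop : MulAction.stabilizer G (S : Set Ω) = ⊤ := by
    rw [eq_top_iff, ← hgen, Subgroup.closure_le]
    rintro g (rfl | rfl) <;> refine hS' _ fun p hp => ?_
    · have := ((hstep p (hlt p hp)).resolve_left (by simp [hp])).1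
      have hm := hS _ this
      rwa [h.point_root, point_shift hx, pow_one] at hm
    · have := ((hstep p (hlt p hp)).resolve_left (by simp [hp])).2
      split at this
      · cases this
      · next t ht =>
        have hm := hS _ this
        rwa [h.point_root, ← h.act p t ht] at hm
  have hsub : MulAction.orbit G (φ 0) ⊆ S := by
    rintro _ ⟨g, rfl⟩
    have hg : g ∈ MulAction.stabilizer G (S : Set Ω) := htop ▸ Subgroup.mem_top g
    have h0 : φ 0 ∈ S := by
      have := hS _ hbase
      rw [h.point_root] at this
      simpa [point] using this
    rw [← MulAction.mem_stabilizer_iff.1 hg]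
    exact Set.smul_mem_smul_set h0
  refine ⟨S.finite_toSet.subset hsub, (Set.ncard_le_ncard hsub S.finite_toSet).trans ?_⟩
  rw [Set.ncard_coe_finset]
  refine (List.toFinset_card_le _).trans ?_
  rw [List.length_map, ← List.countP_eq_length_filter]
  exact Nat.le_of_ble_eq_true hcount

end Soundness

theorem wordInv_append_cons {G : Type*} [Group G] {x a b c : G} {e e' n : ℕ}
    (hb : x ^ e * a = b) (hc : x ^ e' * a = c) (h : (c * b ^ n) ^ 2 = 1) :
    wordInv x a (List.replicate n e ++ e' :: (List.replicate n e ++ [e'])) = 1 := by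
  have : wordInv x a (List.replicate n e ++ e' :: (List.replicate n e ++ [e'])) =
      ((c * b ^ n) ^ 2)⁻¹ := by
    simp only [wordInv, List.map_append, List.map_cons, List.map_replicate, List.map_nil, hb, hc,
      List.prod_append, List.prod_cons, List.prod_replicate, List.prod_nil]
    simp only [pow_two, mul_inv_rev, inv_pow]
    group
  rw [this, h, inv_one]

theorem wordInv_relators {G : Type*} [Group G] {x y : G} (hx : x ^ 31 = 1) (hy : y ^ 31 = 1)
    (h1 : (x * y ^ 2) ^ 2 = 1) (h2 : (x ^ 3 * y ^ (-11 : ℤ)) ^ 2 = 1)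
    (h3 : (x ^ 4 * y ^ 13) ^ 2 = 1) : ∀ w ∈ relators, wordInv x (x ^ 2 * y) w = 1 := by
  have e29 : x ^ 29 * (x ^ 2 * y) = y := by rw [← mul_assoc, ← pow_add, hx, one_mul]
  have e30 : x ^ 30 * (x ^ 2 * y) = x * y := by
    rw [← mul_assoc, ← pow_add, pow_succ', hx, mul_one]
  have e26 : x ^ 26 * (x ^ 2 * y) = (x ^ 3)⁻¹ * y := by
    rw [eq_inv_mul_iff_mul_eq, ← mul_assoc, ← mul_assoc, ← pow_add, ← pow_add, hx, one_mul]
  have e2 : x ^ 2 * (x ^ 2 * y) = x ^ 4 * y := by rw [← mul_assoc, ← pow_add]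
  have h2' : ((x ^ 3)⁻¹ * y ^ 11) ^ 2 = 1 := by
    have h : (x ^ 3 * y ^ (-11 : ℤ))⁻¹ ^ 2 = 1 := by rw [inv_pow, h2, inv_one]
    have h' : (x ^ 3)⁻¹ * y ^ 11 = (y ^ 11)⁻¹ * (x ^ 3 * y ^ (-11 : ℤ))⁻¹ * ((y ^ 11)⁻¹)⁻¹ := by
      group
    rw [h', conj_pow, h, mul_one, mul_inv_cancel]
  have w1 := wordInv_append_cons (n := 1) e29 e30 (by rwa [pow_one, mul_assoc, ← pow_two])
  have w2 := wordInv_append_cons (n := 10) e29 e26 (by rwa [mul_assoc, ← pow_succ'])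
  have w3 := wordInv_append_cons (n := 12) e29 e2 (by rwa [mul_assoc, ← pow_succ'])
  intro w hw
  simp only [relators, List.mem_append, List.mem_cons, List.mem_map, List.not_mem_nil,
    or_false] at hw
  rcases hw with ((rfl | rfl | rfl) | ⟨n, -, rfl⟩) | ⟨n, -, rfl⟩
  · rw [wordInv, List.map_replicate, e29, List.prod_replicate, inv_pow, hy, inv_one]
  · exact w1
  · exact wordInv_rotate w1 1
  · exact wordInv_rotate w2 n
  · exact wordInv_rotate w3 n

theorem map_relations {G : Type*} [Group G] (f : FreeGroup (Fin 2) →* G)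
    (hf : ∀ r ∈ Hrels, f r = 1) :
    f (.of 0) ^ 31 = 1 ∧ f (.of 1) ^ 31 = 1 ∧ (f (.of 0) ^ 2 * f (.of 1)) ^ 2 = 1 ∧
      (f (.of 0) * f (.of 1) ^ 2) ^ 2 = 1 ∧ (f (.of 0) ^ 3 * f (.of 1) ^ (-11 : ℤ)) ^ 2 = 1 ∧
      (f (.of 0) ^ 4 * f (.of 1) ^ 13) ^ 2 = 1 := by
  simpa only [Hrels, Set.mem_insert_iff, Set.mem_singleton_iff, forall_eq_or_imp, forall_eq,
    map_mul, map_pow, map_zpow] using hf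

/-- The upper bound on the index of `⟨x⟩`. -/
theorem index_zpowers_le : (Subgroup.zpowers (PresentedGroup.of 0 : Hbar)).index ≠ 0 ∧
    (Subgroup.zpowers (PresentedGroup.of 0 : Hbar)).index ≤ 1056 := by
  set x : Hbar := PresentedGroup.of 0
  set y : Hbar := PresentedGroup.of 1
  obtain ⟨hx, hy, ha, h1, h2, h3⟩ :=
    map_relations (PresentedGroup.mk Hrels) fun _ => PresentedGroup.one_of_mem
  change x ^ 31 = 1 at hx
  change y ^ 31 = 1 at hy
  change (x ^ 2 * y) ^ 2 = 1 at ha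
  have hgen' : Subgroup.closure {x, x ^ 2 * y} = ⊤ := by
    rw [eq_top_iff, ← PresentedGroup.closure_range_of Hrels, Subgroup.closure_le]
    have hxm : x ∈ Subgroup.closure {x, x ^ 2 * y} := Subgroup.subset_closure (by simp)
    have ham : x ^ 2 * y ∈ Subgroup.closure {x, x ^ 2 * y} := Subgroup.subset_closure (by simp)
    rintro _ ⟨i, rfl⟩
    fin_cases i
    · exact hxm
    · exact (Subgroup.mul_mem_cancel_left _ (pow_mem hxm 2)).1 ham
  have hω : x • ((1 : Hbar) : Hbar ⧸ Subgroup.zpowers x) = ((1 : Hbar) : Hbar ⧸ _) := by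
    rw [MulAction.Quotient.smul_coe, QuotientGroup.eq]
    simp
  obtain ⟨φ, h0, hφ⟩ := exists_sound_final hx (by rw [← pow_two, ha])
    (wordInv_relators hx hy h1 h2 h3) hω
  have := hφ.orbit_card_le hx closed_final hgen'
  rw [MulAction.orbit_eq_univ, Set.ncard_univ, Set.finite_univ_iff] at this
  obtain ⟨_, hcard⟩ := this
  exact ⟨Subgroup.index_ne_zero_of_finite, hcard⟩

end CosetEnumeration

/-! ### The action on the projective line over the field with 32 elements -/

namespace ProjectiveLine

/-- The action of `x`, fixing the points 31 and 32. -/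
def permX : Equiv.Perm (Fin 33) where
  toFun i := if i < 30 then i + 1 else if i = 30 then 0 else i
  invFun i := if i = 0 then 30 else if i < 31 then i - 1 else i
  left_inv := by decide
  right_inv := by decide

/-- The action of the involution `x ^ 2 * y`. -/
def permA : Equiv.Perm (Fin 33) :=
  Function.Involutive.toPerm
    ![31, 30, 13, 15, 28, 9, 18, 23, 19, 5, 27, 25, 16, 2, 29, 3, 12, 24, 6, 8, 22, 32, 20, 7, 17,
      11, 26, 10, 4, 14, 1, 0, 21] (by unfold Function.Involutive; decide)

/-- The images of the two generators. -/
def perms : Fin 2 → Equiv.Perm (Fin 33) := ![permX, permX⁻¹ * permX⁻¹ * permA]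

theorem lift_perms_eq_one : ∀ r ∈ Hrels, FreeGroup.lift perms r = 1 := by
  simp only [Hrels, Set.mem_insert_iff, Set.mem_singleton_iff, forall_eq_or_imp, forall_eq,
    map_mul, map_pow, map_zpow, FreeGroup.lift_apply_of]
  decide +kernel

/-- The action of `Hbar` on the projective line. -/
def action : Hbar →* Equiv.Perm (Fin 33) := PresentedGroup.toGroup lift_perms_eq_one

theorem exists_permX_permA_eq :
    ∀ i, i = 31 ∨ ∃ k : Fin 31,
      (permA * permX ^ (k : ℕ)) i = 31 ∨ (permA * permX ^ (k : ℕ) * permA) i = 31 := by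
  decide +kernel

theorem exists_stabilizing_eq :
    ∀ j, j = 31 ∨ j = 32 ∨ ∃ k : Fin 31,
      (permA * permX ^ 18 * permA * permX ^ 2 * permA * permX ^ (k : ℕ)) j = 32 := by
  decide +kernel

theorem permA_mul_stabilizes :
    (permA * permX ^ 18 * permA * permX ^ 2 * permA) 31 = 31 := by
  decide +kernel

theorem permX_apply_31 : permX 31 = 31 := by decide

theorem permX_apply_32 : permX 32 = 32 := by decide

theorem action_of_zero : action (PresentedGroup.of 0) = permX :=
  PresentedGroup.toGroup.of _

theorem exists_action_eq_permA : ∃ a : Hbar, action a = permA := by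
  refine ⟨PresentedGroup.of 0 ^ 2 * PresentedGroup.of 1, ?_⟩
  rw [map_mul, map_pow, action_of_zero, action, PresentedGroup.toGroup.of, perms,
    Matrix.cons_val_one, Matrix.cons_val_zero]
  group

/-- The action on the projective line is doubly transitive. -/
theorem exists_action_eq (i j : Fin 33) (hij : i ≠ j) :
    ∃ g : Hbar, action g i = 31 ∧ action g j = 32 := by
  obtain ⟨a, ha⟩ := exists_action_eq_permA
  have hx := action_of_zero
  set x : Hbar := PresentedGroup.of 0
  have h1 : ∃ g : Hbar, action g i = 31 := by
    rcases exists_permX_permA_eq i with rfl | ⟨k, hk | hk⟩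
    · exact ⟨1, by simp⟩
    · exact ⟨a * x ^ (k : ℕ), by simpa only [map_mul, map_pow, ha, hx] using hk⟩
    · exact ⟨a * x ^ (k : ℕ) * a, by simpa only [map_mul, map_pow, ha, hx] using hk⟩
  obtain ⟨g, hg⟩ := h1
  have h2 : ∃ h : Hbar, action h 31 = 31 ∧ action h (action g j) = 32 := by
    rcases exists_stabilizing_eq (action g j) with h | h | ⟨k, hk⟩
    · exact absurd ((action g).injective (hg.trans h.symm)) hij
    · exact ⟨1, by simp [h]⟩
    · refine ⟨a * x ^ 18 * a * x ^ 2 * a * x ^ (k : ℕ), ?_, ?_⟩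
      · rw [map_mul, map_pow action x, hx, Equiv.Perm.mul_apply,
          Equiv.Perm.pow_apply_eq_self_of_apply_eq_self permX_apply_31]
        simpa only [map_mul, map_pow, ha, hx] using permA_mul_stabilizes
      · simpa only [map_mul, map_pow, ha, hx] using hk
  obtain ⟨h, hh1, hh2⟩ := h2
  exact ⟨h * g, by simp [hg, hh1], by simp [hh2]⟩

/-- The lower bound on the index of `⟨x⟩`, the stabilizer of two points. -/
theorem dvd_index_zpowers :
    1056 ∣ (Subgroup.zpowers (PresentedGroup.of 0 : Hbar)).index := by
  let _ : MulAction Hbar (Fin 33) := MulAction.compHom (Fin 33) action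
  have hsmul : ∀ (g : Hbar) (i : Fin 33), g • i = action g i := fun _ _ => rfl
  have horb : MulAction.orbit Hbar ((31, 32) : Fin 33 × Fin 33) =
      ((Finset.univ : Finset (Fin 33)).offDiag : Set (Fin 33 × Fin 33)) := by
    ext ⟨i, j⟩
    simp only [Finset.mem_coe, Finset.mem_offDiag, Finset.mem_univ, true_and]
    constructor
    · rintro ⟨g, hg⟩ rfl
      simp only [Prod.smul_mk, Prod.mk.injEq] at hg
      exact absurd (smul_left_cancel g (hg.1.trans hg.2.symm)) (by decide)
    · intro hij
      obtain ⟨g, hi, hj⟩ := exists_action_eq i j hij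
      exact ⟨g⁻¹, inv_smul_eq_iff.2 (Prod.ext hi.symm hj.symm)⟩
  have hindex : (MulAction.stabilizer Hbar ((31, 32) : Fin 33 × Fin 33)).index = 1056 := by
    rw [MulAction.index_stabilizer, horb, Set.ncard_coe_finset, Finset.offDiag_card]
    simp
  rw [← hindex]
  refine Subgroup.index_dvd_of_le ?_
  rw [Subgroup.zpowers_le, MulAction.mem_stabilizer_iff, Prod.smul_mk, hsmul, hsmul,
    action_of_zero, permX_apply_31, permX_apply_32]

end ProjectiveLine

/-- The cyclic subgroup generated by x has index 1056 in H̄. -/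
theorem Hbar_index_x :
    (Subgroup.zpowers ((PresentedGroup.of 0 : Hbar))).index = 1056 := by
  obtain ⟨hne, hle⟩ := CosetEnumeration.index_zpowers_le
  exact le_antisymm hle (Nat.le_of_dvd (Nat.pos_of_ne_zero hne) ProjectiveLine.dvd_index_zpowers)
end
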